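/- Let X = (ℝ/ℤ)² with Haar probability measure μ, f(x,y) = (x+y,y), φ(x,y) = e(x), and for each prime p let a_p be an integer with 0 ≤ a_p < p; set s_p(x,y) = (1/p) Σ_{0 ≤ n < p} e(−n a_p/p) φ(fⁿ(x,y)). Let (ψ_p)_p be nonnegative reals with ψ_p → +∞, and let P be an infinite set of primes with Σ_{p ∈ P} ψ_p/p < +∞. Then for μ-almost every (x,y) ∈ X, s_p(x,y) → 0 as p → +∞ along P. -/

import Mathlib

open MeasureTheory
open scoped Real

/-- `e(t) = exp(2πit)`. -/
noncomputable def e (t : ℝ) : ℂ := Complex.exp (2 * Real.pi * Complex.I * t)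

/-- `s_p(x,y) = (1/p) Σ_{0 ≤ n < p} e(-n a_p/p) φ(fⁿ(x,y))` on the torus `X = (ℝ/ℤ)²`,
where `f(x,y) = (x+y,y)` (so `fⁿ(x,y) = (x+ny,y)`) and `φ(x,y) = e(x)`. -/
noncomputable def sTorus (a : ℕ → ℕ) (p : ℕ) (z : UnitAddCircle × UnitAddCircle) : ℂ :=
  ((p : ℂ))⁻¹ * ∑ n ∈ Finset.range p,
    e (-(n : ℝ) * (a p : ℝ) / (p : ℝ)) * (AddCircle.toCircle (z.1 + n • z.2) : ℂ)

/-- The circle norm is controlled by the chord: `4‖u‖ ≤ ‖e(u) - 1‖`. -/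
theorem UnitAddCircle.four_mul_norm_le_norm_toCircle_sub_one (u : UnitAddCircle) :
    4 * ‖u‖ ≤ ‖(AddCircle.toCircle u : ℂ) - 1‖ := by
  obtain ⟨x, rfl⟩ := QuotientAddGroup.mk_surjective u
  set t : ℝ := x - round x with ht
  have hxt : ((x : ℝ) : UnitAddCircle) = (t : UnitAddCircle) := by
    rw [ht, AddCircle.coe_sub, eq_comm, sub_eq_self, AddCircle.coe_eq_zero_iff]
    exact ⟨round x, by simp⟩
  have hnorm : ‖(x : UnitAddCircle)‖ = |t| := UnitAddCircle.norm_eq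
  have habs : |t| ≤ 1 / 2 := abs_sub_round x
  have hsin : 2 * |t| ≤ |Real.sin (π * t)| := by
    have h := Real.mul_le_sin (x := π * |t|) (by positivity) (by nlinarith [Real.pi_pos])
    have habs_sin : Real.sin (π * |t|) ≤ |Real.sin (π * t)| := by
      rcases abs_choice t with h' | h' <;> rw [h']
      · exact le_abs_self _
      · rw [mul_neg, Real.sin_neg]
        exact neg_le_abs _
    refine le_trans (le_of_eq ?_) (h.trans habs_sin)
    field_simp
  have hchord : ‖(AddCircle.toCircle (t : UnitAddCircle) : ℂ) - 1‖ = 2 * |Real.sin (π * t)| := by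
    rw [AddCircle.toCircle_apply_mk, Circle.coe_exp, mul_comm _ Complex.I,
      Complex.norm_exp_I_mul_ofReal_sub_one, norm_mul, Real.norm_eq_abs, Real.norm_eq_abs]
    norm_num
    ring_nf
  change 4 * ‖(x : UnitAddCircle)‖ ≤ ‖(AddCircle.toCircle (x : UnitAddCircle) : ℂ) - 1‖
  rw [hnorm, hxt, hchord]
  linarith

theorem norm_geom_sum_mul_norm_sub_one_le {w : ℂ} (hw : ‖w‖ = 1) (N : ℕ) :
    ‖∑ n ∈ Finset.range N, w ^ n‖ * ‖w - 1‖ ≤ 2 := by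
  rw [← norm_mul, geom_sum_mul]
  calc ‖w ^ N - 1‖ ≤ ‖w ^ N‖ + ‖(1 : ℂ)‖ := norm_sub_le _ _
    _ = 2 := by rw [norm_pow, hw]; norm_num

theorem e_eq_toCircle (t : ℝ) : e t = (AddCircle.toCircle (t : UnitAddCircle) : ℂ) := by
  rw [e, AddCircle.toCircle_apply_mk, Circle.coe_exp]
  congr 1
  push_cast
  ring

theorem norm_sTorus (a : ℕ → ℕ) (p : ℕ) (z : UnitAddCircle × UnitAddCircle) :
    ‖sTorus a p z‖ = (p : ℝ)⁻¹ * ‖∑ n ∈ Finset.range p,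
      (AddCircle.toCircle (z.2 - (((a p : ℝ) / p : ℝ) : UnitAddCircle)) : ℂ) ^ n‖ := by
  have h : ∑ n ∈ Finset.range p, e (-(n : ℝ) * (a p : ℝ) / (p : ℝ)) *
        (AddCircle.toCircle (z.1 + n • z.2) : ℂ) =
      (AddCircle.toCircle z.1 : ℂ) * ∑ n ∈ Finset.range p,
        (AddCircle.toCircle (z.2 - (((a p : ℝ) / p : ℝ) : UnitAddCircle)) : ℂ) ^ n := by
    rw [Finset.mul_sum]
    refine Finset.sum_congr rfl fun n _ => ?_
    rw [e_eq_toCircle, ← Circle.coe_pow, ← AddCircle.toCircle_nsmul, ← Circle.coe_mul,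
      ← Circle.coe_mul, ← AddCircle.toCircle_add, ← AddCircle.toCircle_add]
    congr 2
    have : ((-(n : ℝ) * (a p : ℝ) / (p : ℝ) : ℝ) : UnitAddCircle) =
        -(n • (((a p : ℝ) / p : ℝ) : UnitAddCircle)) := by
      rw [← AddCircle.coe_nsmul, ← AddCircle.coe_neg, nsmul_eq_mul]
      congr 1
      ring
    rw [this, nsmul_sub]
    abel
  rw [sTorus, h, norm_mul, norm_mul, Circle.norm_coe, one_mul, norm_inv, Complex.norm_natCast]

/-- Away from the resonance `y = a_p/p`, the average decays like `1/(2pd)`,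
where `d` is the distance to the resonance. -/
theorem norm_sTorus_mul_le_one (a : ℕ → ℕ) {p : ℕ} (hp : 0 < p)
    (z : UnitAddCircle × UnitAddCircle) :
    ‖sTorus a p z‖ * (p * dist z.2 (((a p : ℝ) / p : ℝ) : UnitAddCircle)) ≤ 1 := by
  have hp' : (p : ℝ) ≠ 0 := by positivity
  set u : UnitAddCircle := z.2 - (((a p : ℝ) / p : ℝ) : UnitAddCircle) with hu
  have h1 := norm_geom_sum_mul_norm_sub_one_le (Circle.norm_coe (AddCircle.toCircle u)) p
  have h2 := mul_le_mul_of_nonneg_left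
    (UnitAddCircle.four_mul_norm_le_norm_toCircle_sub_one u)
    (norm_nonneg (∑ n ∈ Finset.range p, (AddCircle.toCircle u : ℂ) ^ n))
  rw [norm_sTorus, dist_eq_norm, ← hu]
  calc _ = ‖∑ n ∈ Finset.range p, (AddCircle.toCircle u : ℂ) ^ n‖ * ‖u‖ := by
        field_simp
    _ ≤ 1 := by linarith

theorem volume_setOf_dist_snd_le (c : UnitAddCircle) (r : ℝ) :
    volume {z : UnitAddCircle × UnitAddCircle | dist z.2 c ≤ r} ≤ ENNReal.ofReal (2 * r) := by
  have : {z : UnitAddCircle × UnitAddCircle | dist z.2 c ≤ r} =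
      Set.univ ×ˢ Metric.closedBall c r := by
    ext z
    simp
  rw [this, Measure.volume_eq_prod, Measure.prod_prod, AddCircle.volume_closedBall]
  simp only [UnitAddCircle.measure_univ, one_mul]
  exact ENNReal.ofReal_le_ofReal (min_le_right _ _)

/-- Let `(ψ_p)_p` be nonnegative reals with `ψ_p → ∞` (along the primes) and let `P` be
an infinite set of primes with `Σ_{p ∈ P} ψ_p/p < ∞`. Then for almost every `(x,y)` in
the torus `X = (ℝ/ℤ)²` (with its Haar probability measure), `s_p(x,y) → 0` as `p → ∞`
along `P`. -/
theorem sTorus_ae_tendsto_zero_psi (a : ℕ → ℕ) (ha : ∀ p : ℕ, p.Prime → a p < p)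
    (ψ : ℕ → ℝ) (hψ0 : ∀ p : ℕ, 0 ≤ ψ p)
    (hψ : Filter.Tendsto ψ (Filter.atTop ⊓ Filter.principal {p : ℕ | p.Prime})
      Filter.atTop)
    (P : Set ℕ) (hP : ∀ p ∈ P, p.Prime) (hPinf : P.Infinite)
    (hsum : Summable fun p : P => ψ p / ((p : ℕ) : ℝ)) :
    ∀ᵐ z ∂(volume : Measure (UnitAddCircle × UnitAddCircle)),
      Filter.Tendsto (fun p : ℕ => sTorus a p z)
        (Filter.atTop ⊓ Filter.principal P) (nhds 0) := by
  have hbc : ∀ᵐ z ∂(volume : Measure (UnitAddCircle × UnitAddCircle)),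
      ∀ᶠ p : P in Filter.cofinite,
        ¬ dist z.2 (((a p : ℝ) / (p : ℕ) : ℝ) : UnitAddCircle) ≤ ψ p / ((p : ℕ) : ℝ) := by
    simp only [Filter.eventually_cofinite, not_not]
    refine ae_finite_setOfPred_mem (μ := volume) (s := fun p : P =>
      {z : UnitAddCircle × UnitAddCircle |
        dist z.2 (((a p : ℝ) / (p : ℕ) : ℝ) : UnitAddCircle) ≤ ψ p / ((p : ℕ) : ℝ)}) ?_
    refine ne_top_of_le_ne_top ?_ (ENNReal.tsum_le_tsum fun p => volume_setOf_dist_snd_le _ _)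
    exact (hsum.mul_left 2).tsum_ofReal_ne_top
  filter_upwards [hbc] with z hz
  have hz' : ∀ᶠ p in Filter.atTop ⊓ Filter.principal P,
      ψ p / (p : ℝ) < dist z.2 (((a p : ℝ) / p : ℝ) : UnitAddCircle) := by
    rw [Filter.eventually_inf_principal, ← Nat.cofinite_eq_atTop, Filter.eventually_cofinite]
    rw [Filter.eventually_cofinite] at hz
    refine (hz.image Subtype.val).subset fun p hp => ?_
    simp only [Set.mem_ofPred_eq, Classical.not_imp, not_lt] at hp
    exact ⟨⟨p, hp.1⟩, by simpa using hp.2, rfl⟩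
  have hψP : Filter.Tendsto ψ (Filter.atTop ⊓ Filter.principal P) Filter.atTop :=
    hψ.mono_left (inf_le_inf_left _ (Filter.principal_mono.2 hP))
  refine squeeze_zero_norm' ?_ hψP.inv_tendsto_atTop
  filter_upwards [hz', hψP.eventually_gt_atTop 0,
    Filter.mem_inf_of_right (Filter.mem_principal_self P)] with p hd hpos hpP
  have hp : 0 < p := (hP p hpP).pos
  have hp' : (0 : ℝ) < p := by exact_mod_cast hp
  rw [div_lt_iff₀' hp'] at hd
  rw [Pi.inv_apply, inv_eq_one_div, le_div_iff₀ hpos]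
  exact (mul_le_mul_of_nonneg_left hd.le (norm_nonneg _)).trans (norm_sTorus_mul_le_one a hp z)
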